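/- arXiv:2409.09624 — 2 statements merged into one kernel-verified Lean document; each statement's English description precedes it below -/
import Mathlib

section
/- Let M₀,…,M_{p-1} > 1, let each A_k be analytic on U with A_k(0) = 0, A_k'(0) = 1, |A_k(z)| ≤ M_k on U, and write A_k(z) = Σ_{n≥1} a_{k,n}z^n (so a_{k,1} = 1 and |a_{k,n}| ≤ M_k - 1/M_k for n ≥ 2). If ρ₃ ∈ (0,1) satisfies 1 - Σ_{k=0}^{p-1}(M_k - 1/M_k)·ρ₃^{k+1}(2-ρ₃+k(1-ρ₃))/(1-ρ₃)² - Σ_{k=1}^{p-1}(k+1)ρ₃^k = 0, then F(z) = Σ_{k=0}^{p-1} conj(z)^k A_k(z) is injective on the disk {|z| < ρ₃}. -/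
open Real in
lemma avg_coeff {A : ℂ → ℂ} {r : ℝ} (hr : 0 < r) (hA : DifferentiableOn ℂ A (Metric.closedBall 0 r)) (m : ℕ) :
    circleAverage (fun z => (z ^ m)⁻¹ * A z) 0 r = (m.factorial : ℂ)⁻¹ * iteratedDeriv m A 0 := by
  have h := hA.circleIntegral_one_div_sub_center_pow_smul hr m
  rw [circleAverage_eq_circleIntegral hr.ne']
  have : (fun z : ℂ => (z - 0)⁻¹ • ((z ^ m)⁻¹ * A z)) = fun z => (1 / (z - 0) ^ (m + 1)) • A z := by
    funext z
    simp [pow_succ, mul_comm, mul_left_comm]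
  rw [this, h]
  have h2 : (2 * (π : ℂ) * Complex.I) ≠ 0 := by simp [Real.pi_ne_zero]
  simp only [smul_eq_mul]
  field_simp

open Real in
lemma avg_pos {A : ℂ → ℂ} {r : ℝ} (hr : 0 < r) (hA : DifferentiableOn ℂ A (Metric.closedBall 0 r)) :
    circleAverage A 0 r = A 0 := by
  apply DiffContOnCl.circleAverage
  rw [abs_of_pos hr]
  exact (hA.mono Metric.closure_ball_subset_closedBall).diffContOnCl

lemma kernel_bound (b : ℝ) (ζ w : ℂ) (hζ : ‖ζ‖ = 1) (M : ℝ) (hw : ‖w‖ ≤ M) :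
    0 ≤ ((M * (1 + b ^ 2) : ℝ) + 2 * M * b * ζ - w * (2 * b + b ^ 2 * ζ + ζ⁻¹)).re := by
  have hz0 : ζ ≠ 0 := by intro h; simp [h] at hζ
  have hi : ζ⁻¹ = starRingEnd ℂ ζ := Complex.inv_eq_conj hζ
  have e : (2 * b + b ^ 2 * ζ + ζ⁻¹ : ℂ) = starRingEnd ℂ (b + ζ) * (1 + b * ζ) := by
    simp only [map_add, Complex.conj_ofReal, ← hi]
    field_simp
    ring
  have hsq : ζ.re * ζ.re + ζ.im * ζ.im = 1 := by
    have := Complex.normSq_eq_norm_sq ζ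
    rw [hζ, Complex.normSq_apply] at this
    linarith
  have n1 : ‖(b + ζ : ℂ)‖ ^ 2 = 1 + b ^ 2 + 2 * b * ζ.re := by
    rw [← Complex.normSq_eq_norm_sq, Complex.normSq_apply]
    simp
    linear_combination hsq
  have n2 : ‖(1 + b * ζ : ℂ)‖ ^ 2 = 1 + b ^ 2 + 2 * b * ζ.re := by
    rw [← Complex.normSq_eq_norm_sq, Complex.normSq_apply]
    simp
    linear_combination b ^ 2 * hsq
  have hn : ‖w * (2 * b + b ^ 2 * ζ + ζ⁻¹ : ℂ)‖ ≤ M * (1 + b ^ 2 + 2 * b * ζ.re) := by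
    rw [e, norm_mul, norm_mul, RCLike.norm_conj]
    have : ‖(b + ζ : ℂ)‖ * ‖(1 + b * ζ : ℂ)‖ ≤ 1 + b ^ 2 + 2 * b * ζ.re := by
      nlinarith [sq_nonneg (‖(b + ζ : ℂ)‖ - ‖(1 + b * ζ : ℂ)‖)]
    exact mul_le_mul hw this (by positivity) ((norm_nonneg _).trans hw)
  have := (Complex.re_le_norm _).trans hn
  rw [Complex.sub_re, Complex.add_re]
  have e2 : (2 * M * b * ζ : ℂ).re = 2 * M * b * ζ.re := by
    rw [show (2 * M * b * ζ : ℂ) = ((2 * M * b : ℝ) : ℂ) * ζ by push_cast; ring, Complex.re_ofReal_mul]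
  rw [e2, Complex.ofReal_re]
  linarith

open Real in
lemma coeff_r {A : ℂ → ℂ} {M : ℝ} (hM : 1 < M)
    (hA : DifferentiableOn ℂ A (Metric.ball 0 1)) (h0 : A 0 = 0) (h1 : deriv A 0 = 1)
    (hAM : ∀ z ∈ Metric.ball (0 : ℂ) 1, ‖A z‖ ≤ M) (n : ℕ) (hn : 1 ≤ n) (u : ℂ) (hu : ‖u‖ = 1)
    (r : ℝ) (hr : 0 < r) (hr1 : r < 1) :
    2 * M⁻¹ * r + (u⁻¹ * ((n + 1).factorial : ℂ)⁻¹ * iteratedDeriv (n + 1) A 0).re * r ^ (n + 1)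
      ≤ M + M⁻¹ := by
  have hM0 : (M : ℂ) ≠ 0 := by
    have : M ≠ 0 := by linarith
    exact_mod_cast this
  have hr0 : (r : ℂ) ≠ 0 := by exact_mod_cast hr.ne'
  have hu0 : u ≠ 0 := by intro h; simp [h] at hu
  have hA' : DifferentiableOn ℂ A (Metric.closedBall 0 r) :=
    hA.mono (Metric.closedBall_subset_ball hr1)
  have hAc : ContinuousOn A (Metric.sphere 0 r) :=
    hA'.continuousOn.mono Metric.sphere_subset_closedBall
  have a1 : circleAverage (fun z : ℂ => z ^ n) 0 r = 0 := by
    rw [avg_pos hr (by fun_prop)]; simp; omega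
  have a2 := avg_coeff hr hA' 1
  have a3 : circleAverage (fun z : ℂ => z ^ (n - 1) * A z) 0 r = 0 := by
    rw [avg_pos hr (by fun_prop)]; simp [h0]
  have a4 := avg_coeff hr hA' (n + 1)
  have hne : ∀ z ∈ Metric.sphere (0 : ℂ) r, z ≠ 0 := by
    intro z hz h; subst h; simp at hz; linarith
  have ci : ∀ m, CircleIntegrable (fun z : ℂ => (z ^ m)⁻¹ * A z) 0 r := by
    intro m
    refine ContinuousOn.circleIntegrable hr.le ?_
    refine ContinuousOn.mul (ContinuousOn.inv₀ (by fun_prop) ?_) hAc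
    intro z hz; exact pow_ne_zero _ (hne z hz)
  have ci3 : CircleIntegrable (fun z : ℂ => z ^ (n - 1) * A z) 0 r :=
    ContinuousOn.circleIntegrable hr.le (by fun_prop)
  have ci1 : CircleIntegrable (fun z : ℂ => z ^ n) 0 r :=
    ContinuousOn.circleIntegrable hr.le (by fun_prop)
  have ci0 : CircleIntegrable (fun z : ℂ => ((M + M⁻¹ : ℝ) : ℂ)) 0 r :=
    ContinuousOn.circleIntegrable hr.le (by fun_prop)
  have b1 := ci1.const_smul (a := 2 * u / r ^ n)
  have b2 := (ci 1).const_smul (a := 2 * (M : ℂ)⁻¹ * r)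
  have b3 := ci3.const_smul (a := (M : ℂ)⁻¹ ^ 2 * u * r / r ^ n)
  have b4 := (ci (n + 1)).const_smul (a := u⁻¹ * r ^ (n + 1))
  have cG := (((ci0.add b1).sub b2).sub b3).sub b4
  have key := Complex.reCLM.circleAverage_comp_comm cG
  have hnn := fun h => (circleAverage_nonneg_of_nonneg h).trans_eq key
  specialize hnn (by
    intro z hz
    rw [abs_of_pos hr] at hz
    have hz0 := hne z hz
    have hzn : ‖z‖ = r := by simpa using hz
    have := kernel_bound M⁻¹ (u * z ^ n / r ^ n) (A z * r / z) (by
      simp [hu, hzn, abs_of_pos hr, hr.ne']) M (by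
      have := hAM z (by simp [hzn, hr1])
      simpa [hzn, abs_of_pos hr, hr.ne'] using this)
    convert this using 1
    simp only [Function.comp, Complex.reCLM_apply]
    congr 1
    simp only [Pi.sub_apply, Pi.add_apply, Pi.smul_apply, smul_eq_mul]
    obtain ⟨k, rfl⟩ : ∃ k, n = k + 1 := ⟨n - 1, by omega⟩
    simp only [Nat.add_sub_cancel]
    push_cast
    field_simp
    ring)
  rw [circleAverage_sub (((ci0.add b1).sub b2).sub b3) b4,
    circleAverage_sub ((ci0.add b1).sub b2) b3,
    circleAverage_sub (ci0.add b1) b2, circleAverage_add ci0 b1, circleAverage_smul,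
    circleAverage_smul, circleAverage_smul, circleAverage_smul, circleAverage_const,
    a1, a2, a3, a4] at hnn
  simp only [iteratedDeriv_one, h1, smul_eq_mul, mul_zero, add_zero, sub_zero,
    Complex.reCLM_apply, Complex.sub_re, Complex.ofReal_re] at hnn
  have e1 : (2 * (M : ℂ)⁻¹ * r * ((Nat.factorial 1 : ℕ) : ℂ)⁻¹ * 1).re = 2 * M⁻¹ * r := by
    rw [show (2 * (M : ℂ)⁻¹ * r * ((Nat.factorial 1 : ℕ) : ℂ)⁻¹ * 1) = ((2 * M⁻¹ * r : ℝ) : ℂ) by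
      push_cast; simp]
    exact Complex.ofReal_re _
  have e2 : (u⁻¹ * (r : ℂ) ^ (n + 1) * (((n + 1).factorial : ℂ)⁻¹ * iteratedDeriv (n + 1) A 0)).re
      = (u⁻¹ * ((n + 1).factorial : ℂ)⁻¹ * iteratedDeriv (n + 1) A 0).re * r ^ (n + 1) := by
    rw [← Complex.re_mul_ofReal]
    push_cast
    congr 1
    ring
  rw [e2, ← mul_assoc, e1] at hnn
  linarith

lemma coeff_bound {A : ℂ → ℂ} {M : ℝ} (hM : 1 < M)
    (hA : DifferentiableOn ℂ A (Metric.ball 0 1)) (h0 : A 0 = 0) (h1 : deriv A 0 = 1)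
    (hAM : ∀ z ∈ Metric.ball (0 : ℂ) 1, ‖A z‖ ≤ M) (n : ℕ) :
    ‖((n + 2).factorial : ℂ)⁻¹ * iteratedDeriv (n + 2) A 0‖ ≤ M - 1 / M := by
  set a := ((n + 2).factorial : ℂ)⁻¹ * iteratedDeriv (n + 2) A 0 with ha
  have hMi : M⁻¹ < 1 := inv_lt_one_of_one_lt₀ hM
  rcases eq_or_ne a 0 with h | h
  · rw [h, norm_zero, one_div]; linarith
  have hna : (‖a‖ : ℂ) ≠ 0 := by simpa using h
  have key : ∀ r ∈ Set.Ioo (0 : ℝ) 1, 2 * M⁻¹ * r + ‖a‖ * r ^ (n + 2) ≤ M + M⁻¹ := by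
    intro r hr
    have := coeff_r hM hA h0 h1 hAM (n + 1) (by omega) (a / ‖a‖) (by simp [h]) r hr.1 hr.2
    rw [mul_assoc _ _ (iteratedDeriv _ _ _), ← ha, inv_div, div_mul_cancel₀ _ h,
      Complex.ofReal_re] at this
    exact this
  have lim : Filter.Tendsto (fun r : ℝ => 2 * M⁻¹ * r + ‖a‖ * r ^ (n + 2)) (nhdsWithin 1 (Set.Iio 1))
      (nhds (2 * M⁻¹ * 1 + ‖a‖ * 1 ^ (n + 2))) := by
    apply Filter.Tendsto.mono_left _ nhdsWithin_le_nhds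
    exact Continuous.tendsto (by fun_prop) 1
  have := le_of_tendsto lim (Filter.eventually_of_mem (Ioo_mem_nhdsLT one_pos) key)
  rw [one_div]
  simp at this
  linarith

lemma pow_diff (z w : ℂ) (r : ℝ) (hr : 0 ≤ r) (hz : ‖z‖ ≤ r) (hw : ‖w‖ ≤ r) (n : ℕ) :
    ‖z ^ (n + 1) - w ^ (n + 1)‖ ≤ (n + 1) * r ^ n * ‖z - w‖ := by
  induction n with
  | zero => simp
  | succ n ih =>
    have e : z ^ (n + 1 + 1) - w ^ (n + 1 + 1) = z * (z ^ (n + 1) - w ^ (n + 1)) + (z - w) * w ^ (n + 1) := by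
      ring
    have t1 : ‖z * (z ^ (n + 1) - w ^ (n + 1))‖ ≤ r * ((n + 1) * r ^ n * ‖z - w‖) := by
      rw [norm_mul]; gcongr
    have t2 : ‖(z - w) * w ^ (n + 1)‖ ≤ ‖z - w‖ * r ^ (n + 1) := by
      rw [norm_mul, norm_pow]; gcongr
    rw [e]
    refine (norm_add_le _ _).trans ((add_le_add t1 t2).trans (le_of_eq ?_))
    push_cast
    ring

lemma conj_pow_diff (z w : ℂ) (r : ℝ) (hr : 0 ≤ r) (hz : ‖z‖ ≤ r) (hw : ‖w‖ ≤ r) (k n : ℕ) :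
    ‖(starRingEnd ℂ z) ^ k * z ^ (n + 1) - (starRingEnd ℂ w) ^ k * w ^ (n + 1)‖
      ≤ (n + 1 + k) * r ^ (n + k) * ‖z - w‖ := by
  induction k with
  | zero => simpa using pow_diff z w r hr hz hw n
  | succ k ih =>
    have e : (starRingEnd ℂ z) ^ (k + 1) * z ^ (n + 1) - (starRingEnd ℂ w) ^ (k + 1) * w ^ (n + 1)
      = starRingEnd ℂ z * ((starRingEnd ℂ z) ^ k * z ^ (n + 1) - (starRingEnd ℂ w) ^ k * w ^ (n + 1))
        + (starRingEnd ℂ (z - w)) * ((starRingEnd ℂ w) ^ k * w ^ (n + 1)) := by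
      rw [map_sub]; ring
    rw [e]
    have t1 : ‖starRingEnd ℂ z * ((starRingEnd ℂ z) ^ k * z ^ (n + 1) - (starRingEnd ℂ w) ^ k * w ^ (n + 1))‖
        ≤ r * ((n + 1 + k) * r ^ (n + k) * ‖z - w‖) := by
      rw [norm_mul, RCLike.norm_conj]; gcongr
    have t2 : ‖(starRingEnd ℂ (z - w)) * ((starRingEnd ℂ w) ^ k * w ^ (n + 1))‖
        ≤ ‖z - w‖ * (r ^ k * r ^ (n + 1)) := by
      rw [norm_mul, norm_mul, norm_pow, norm_pow, RCLike.norm_conj, RCLike.norm_conj]; gcongr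
    refine (norm_add_le _ _).trans ((add_le_add t1 t2).trans (le_of_eq ?_))
    push_cast
    ring

lemma sum_closed (r : ℝ) (hr : 0 ≤ r) (hr1 : r < 1) (k : ℕ) :
    HasSum (fun n : ℕ => ((n : ℝ) + 2 + k) * r ^ (n + 1 + k))
      (r ^ (k + 1) * (2 - r + (k : ℝ) * (1 - r)) / (1 - r) ^ 2) := by
  have hn : ‖r‖ < 1 := by rwa [Real.norm_of_nonneg hr]
  have s1 := hasSum_coe_mul_geometric_of_norm_lt_one hn
  have s2 := (hasSum_geometric_of_lt_one hr hr1).mul_left (2 + (k : ℝ))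
  have s := (s1.add s2).mul_left (r ^ (k + 1))
  have h1 : 1 - r ≠ 0 := by linarith
  convert! s using 1
  · funext n; ring
  · field_simp; ring

/-- the difference of the parts of order at least two -/
lemma tail_diff {A : ℂ → ℂ} {M : ℝ} (hM : 1 < M)
    (hA : DifferentiableOn ℂ A (Metric.ball 0 1)) (h0 : A 0 = 0) (h1 : deriv A 0 = 1)
    (hAM : ∀ z ∈ Metric.ball (0 : ℂ) 1, ‖A z‖ ≤ M) (k : ℕ)
    (z w : ℂ) (r : ℝ) (hr : 0 ≤ r) (hr1 : r < 1) (hz : ‖z‖ ≤ r) (hw : ‖w‖ ≤ r) :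
    ‖(starRingEnd ℂ z) ^ k * (A z - z) - (starRingEnd ℂ w) ^ k * (A w - w)‖
      ≤ (M - 1 / M) * (r ^ (k + 1) * (2 - r + (k : ℝ) * (1 - r)) / (1 - r) ^ 2) * ‖z - w‖ := by
  have ser : ∀ z : ℂ, ‖z‖ ≤ r → HasSum (fun n : ℕ => ((n + 2).factorial : ℂ)⁻¹ *
      iteratedDeriv (n + 2) A 0 * ((starRingEnd ℂ z) ^ k * z ^ (n + 1 + 1)))
      ((starRingEnd ℂ z) ^ k * (A z - z)) := by
    intro z hz
    have h := Complex.hasSum_taylorSeries_on_ball hA (z := z) (by simp; linarith)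
    rw [← hasSum_nat_add_iff' 2] at h
    have h := h.mul_left ((starRingEnd ℂ z) ^ k)
    convert! h using 1
    · funext n; simp only [smul_eq_mul, sub_zero]; ring
    · simp [Finset.sum_range_succ, h0, h1]
  have hs := (ser z hz).sub (ser w hw)
  rw [← hs.tsum_eq]
  refine tsum_of_norm_bounded (((sum_closed r hr hr1 k).mul_left (M - 1 / M)).mul_right ‖z - w‖) ?_
  intro n
  rw [← mul_sub, norm_mul, mul_assoc]
  have hb := coeff_bound hM hA h0 h1 hAM n
  refine mul_le_mul hb ?_ (norm_nonneg _) ((norm_nonneg _).trans hb)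
  refine (conj_pow_diff z w r hr hz hw k (n + 1)).trans (le_of_eq ?_)
  push_cast
  ring

theorem stmt14 (p : ℕ) (hp : 0 < p) (M : ℕ → ℝ)
    (hM : ∀ k ∈ Finset.range p, 1 < M k)
    (A : ℕ → ℂ → ℂ)
    (hA : ∀ k ∈ Finset.range p, DifferentiableOn ℂ (A k) (Metric.ball 0 1))
    (hA0 : ∀ k ∈ Finset.range p, A k 0 = 0)
    (hA'0 : ∀ k ∈ Finset.range p, deriv (A k) 0 = 1)
    (hAM : ∀ k ∈ Finset.range p, ∀ z ∈ Metric.ball (0 : ℂ) 1, ‖A k z‖ ≤ M k)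
    (F : ℂ → ℂ)
    (hF : ∀ z, F z = ∑ k ∈ Finset.range p, (starRingEnd ℂ z) ^ k * A k z)
    (ρ₃ : ℝ) (hρ₃ : ρ₃ ∈ Set.Ioo (0 : ℝ) 1)
    (hroot : 1 - (∑ k ∈ Finset.range p,
        (M k - 1 / M k) * (ρ₃ ^ (k + 1) * (2 - ρ₃ + (k : ℝ) * (1 - ρ₃)) / (1 - ρ₃) ^ 2))
      - (∑ k ∈ Finset.Icc 1 (p - 1), ((k : ℝ) + 1) * ρ₃ ^ k) = 0) :
    Set.InjOn F (Metric.ball 0 ρ₃) := by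
  intro z hz w hw hFzw
  by_contra hne
  obtain ⟨hρ0, hρ1⟩ := hρ₃
  set r := max ‖z‖ ‖w‖ with hrdef
  have hzr : ‖z‖ ≤ r := le_max_left _ _
  have hwr : ‖w‖ ≤ r := le_max_right _ _
  have hr : 0 ≤ r := (norm_nonneg z).trans hzr
  have hrρ : r < ρ₃ := max_lt (by simpa using hz) (by simpa using hw)
  have hr1 : r < 1 := hrρ.trans hρ1
  have hd : 0 < ‖z - w‖ := norm_pos_iff.2 (sub_ne_zero.2 hne)
  set T : ℂ → ℂ := fun z => ∑ k ∈ Finset.range p, (starRingEnd ℂ z) ^ k * (A k z - z) with hT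
  set S : ℂ → ℂ := fun z => ∑ k ∈ Finset.Icc 1 (p - 1), (starRingEnd ℂ z) ^ k * z ^ (0 + 1) with hS
  have hsplit : ∀ z, F z = z + T z + S z := by
    intro z
    have e : ∑ k ∈ Finset.range p, (starRingEnd ℂ z) ^ k * z = z + S z := by
      obtain ⟨q, rfl⟩ : ∃ q, p = q + 1 := ⟨p - 1, by omega⟩
      rw [Finset.sum_range_succ', hS]
      simp only [Nat.add_sub_cancel, pow_zero, one_mul, zero_add, pow_one]
      rw [add_comm, Finset.range_eq_Ico, Finset.sum_Ico_add' (fun k => (starRingEnd ℂ z) ^ k * z) 0 q 1]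
      congr 1
    have : F z = T z + ∑ k ∈ Finset.range p, (starRingEnd ℂ z) ^ k * z := by
      rw [hF, hT, ← Finset.sum_add_distrib]
      refine Finset.sum_congr rfl fun k _ => by ring
    rw [this, e]; ring
  have hTb : ‖T z - T w‖ ≤ (∑ k ∈ Finset.range p,
        (M k - 1 / M k) * (r ^ (k + 1) * (2 - r + (k : ℝ) * (1 - r)) / (1 - r) ^ 2)) * ‖z - w‖ := by
    simp only [hT]
    rw [← Finset.sum_sub_distrib, Finset.sum_mul]
    refine norm_sum_le_of_le _ fun k hk => ?_
    exact tail_diff (hM k hk) (hA k hk) (hA0 k hk) (hA'0 k hk) (hAM k hk) k z w r hr hr1 hzr hwr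
  have hSb : ‖S z - S w‖ ≤ (∑ k ∈ Finset.Icc 1 (p - 1), ((k : ℝ) + 1) * r ^ k) * ‖z - w‖ := by
    simp only [hS]
    rw [← Finset.sum_sub_distrib, Finset.sum_mul]
    refine norm_sum_le_of_le _ fun k hk => ?_
    refine (conj_pow_diff z w r hr hzr hwr k 0).trans (le_of_eq ?_)
    simp [add_comm]
  have hmono : ∀ k : ℕ, r ^ (k + 1) * (2 - r + (k : ℝ) * (1 - r)) / (1 - r) ^ 2
      < ρ₃ ^ (k + 1) * (2 - ρ₃ + (k : ℝ) * (1 - ρ₃)) / (1 - ρ₃) ^ 2 := by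
    intro k
    have cf : ∀ x : ℝ, x < 1 → x ^ (k + 1) * (2 - x + (k : ℝ) * (1 - x)) / (1 - x) ^ 2
        = x ^ (k + 1) * (1 / (1 - x) ^ 2 + (k + 1) / (1 - x)) := by
      intro x hx
      have : 1 - x ≠ 0 := by linarith
      field_simp; ring
    rw [cf r hr1, cf ρ₃ hρ1]
    have p1 : 0 < 1 - ρ₃ := by linarith
    have p2 : 0 < 1 - r := by linarith
    have q1 : r ^ (k + 1) < ρ₃ ^ (k + 1) := pow_lt_pow_left₀ hrρ hr (by omega)
    have q2 : 1 / (1 - r) ^ 2 + (k + 1) / (1 - r) ≤ 1 / (1 - ρ₃) ^ 2 + (k + 1) / (1 - ρ₃) := by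
      gcongr
    exact mul_lt_mul q1 q2 (by positivity) (by positivity)
  have hMp : ∀ k ∈ Finset.range p, 0 < M k - 1 / M k := by
    intro k hk
    have := inv_lt_one_of_one_lt₀ (hM k hk)
    rw [one_div]; linarith [hM k hk]
  have hlt1 : (∑ k ∈ Finset.range p,
        (M k - 1 / M k) * (r ^ (k + 1) * (2 - r + (k : ℝ) * (1 - r)) / (1 - r) ^ 2))
      < ∑ k ∈ Finset.range p,
        (M k - 1 / M k) * (ρ₃ ^ (k + 1) * (2 - ρ₃ + (k : ℝ) * (1 - ρ₃)) / (1 - ρ₃) ^ 2) := by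
    refine Finset.sum_lt_sum_of_nonempty ⟨0, by simpa using hp⟩ fun k hk => ?_
    exact mul_lt_mul_of_pos_left (hmono k) (hMp k hk)
  have hle2 : (∑ k ∈ Finset.Icc 1 (p - 1), ((k : ℝ) + 1) * r ^ k)
      ≤ ∑ k ∈ Finset.Icc 1 (p - 1), ((k : ℝ) + 1) * ρ₃ ^ k := by
    gcongr
  have heq : z - w = -(T z - T w) - (S z - S w) := by
    have h1 := hsplit z
    have h2 := hsplit w
    linear_combination hFzw - h1 + h2
  have hfin : ‖z - w‖ ≤ ‖T z - T w‖ + ‖S z - S w‖ := by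
    calc ‖z - w‖ = ‖-(T z - T w) - (S z - S w)‖ := by rw [← heq]
      _ ≤ ‖-(T z - T w)‖ + ‖S z - S w‖ := norm_sub_le _ _
      _ = _ := by rw [norm_neg]
  nlinarith
end

section
/- Let Λ > 1, M₁,…,M_{p-1} > 1, and let F(z) = Σ_{k=0}^{p-1} conj(z)^k A_k(z), where each A_k is analytic on U with A_k(0) = 0, A_k'(0) = 1, |A₀'(z)| < Λ on U, and |A_k(z)| ≤ M_k on U for k = 1,…,p-1. If ρ₄ ∈ (0,1) satisfies Λ(1-Λρ₄)/(Λ-ρ₄) - Σ_{k=1}^{p-1}(M_k - 1/M_k)·ρ₄^{k+1}(2-ρ₄+k(1-ρ₄))/(1-ρ₄)² - Σ_{k=1}^{p-1}(k+1)ρ₄^k = 0, then F is injective on the disk {|z| < ρ₄}. -/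
lemma aux_normSq_mob (a b : ℂ) :
    ‖1 - starRingEnd ℂ a * b‖ ^ 2 - ‖b - a‖ ^ 2 = (1 - ‖a‖ ^ 2) * (1 - ‖b‖ ^ 2) := by
  simp only [← Complex.normSq_eq_norm_sq, Complex.normSq_apply]
  simp
  ring

lemma aux_mob_lt {a b : ℂ} (ha : ‖a‖ < 1) (hb : ‖b‖ < 1) :
    ‖b - a‖ < ‖1 - starRingEnd ℂ a * b‖ := by
  have h := aux_normSq_mob a b
  have h1 : 0 < 1 - ‖a‖ ^ 2 := by nlinarith [norm_nonneg a]
  have h2 : 0 < 1 - ‖b‖ ^ 2 := by nlinarith [norm_nonneg b]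
  have := mul_pos h1 h2
  exact lt_of_pow_lt_pow_left₀ 2 (norm_nonneg _) (by linarith)

lemma aux_den_ne {a b : ℂ} (ha : ‖a‖ < 1) (hb : ‖b‖ < 1) :
    1 - starRingEnd ℂ a * b ≠ 0 := by
  have := (norm_nonneg _).trans_lt (aux_mob_lt ha hb)
  exact norm_pos_iff.1 this

lemma aux_mob_norm_lt {a b : ℂ} (ha : ‖a‖ < 1) (hb : ‖b‖ < 1) :
    ‖(b - a) / (1 - starRingEnd ℂ a * b)‖ < 1 := by
  rw [norm_div, div_lt_one (norm_pos_iff.2 (aux_den_ne ha hb))]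
  exact aux_mob_lt ha hb

lemma aux_pick {h : ℂ → ℂ} (hd : DifferentiableOn ℂ h (Metric.ball 0 1))
    (hb : ∀ z ∈ Metric.ball (0 : ℂ) 1, ‖h z‖ < 1) :
    (∀ z ∈ Metric.ball (0 : ℂ) 1, ‖h z - h 0‖ ≤ ‖z‖ * ‖1 - starRingEnd ℂ (h 0) * h z‖) ∧
    ‖deriv h 0‖ ≤ 1 - ‖h 0‖ ^ 2 := by
  have h0 : (0 : ℂ) ∈ Metric.ball (0 : ℂ) 1 := by simp
  have ha := hb 0 h0
  set a := h 0 with ha_def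
  set q : ℂ → ℂ := fun z => (h z - a) / (1 - starRingEnd ℂ a * h z) with hq
  have q0 : q 0 = 0 := by simp [hq, ← ha_def]
  have qd : DifferentiableOn ℂ q (Metric.ball 0 1) :=
    (hd.sub_const a).div ((hd.const_mul _).const_sub 1) (fun z hz => aux_den_ne ha (hb z hz))
  have qm : Set.MapsTo q (Metric.ball 0 1) (Metric.closedBall 0 1) := fun z hz => by
    rw [mem_closedBall_zero_iff]
    exact (aux_mob_norm_lt ha (hb z hz)).le
  constructor
  · intro z hz
    have := Complex.norm_le_norm_of_mapsTo_ball qd qm q0 (by simpa using hz)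
    simp only [hq, norm_div] at this
    rwa [div_le_iff₀ (norm_pos_iff.2 (aux_den_ne ha (hb z hz)))] at this
  · have h1 := Complex.norm_deriv_le_one_of_mapsTo_ball qd (by rwa [q0]) one_pos
    have hda : HasDerivAt h (deriv h 0) 0 :=
      (hd.differentiableAt (Metric.isOpen_ball.mem_nhds h0)).hasDerivAt
    have hdq := (hda.sub_const a).div ((hda.const_mul (starRingEnd ℂ a)).const_sub 1)
      (aux_den_ne ha ha)
    have hden : 1 - starRingEnd ℂ a * a = ((1 - ‖a‖ ^ 2 : ℝ) : ℂ) := by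
      rw [mul_comm, Complex.mul_conj, Complex.normSq_eq_norm_sq]; push_cast; ring
    have hpos : 0 < 1 - ‖a‖ ^ 2 := by nlinarith [norm_nonneg a]
    have hne : ((1 - ‖a‖ ^ 2 : ℝ) : ℂ) ≠ 0 := by exact_mod_cast hpos.ne'
    have hv : deriv q 0 = deriv h 0 / ((1 - ‖a‖ ^ 2 : ℝ) : ℂ) := by
      refine hdq.deriv.trans ?_
      rw [← ha_def, hden, sub_self]
      field_simp
      ring
    rw [hv, norm_div, Complex.norm_real, Real.norm_of_nonneg hpos.le, div_le_one hpos] at h1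
    exact h1

lemma aux_pick_deriv {h : ℂ → ℂ} (hd : DifferentiableOn ℂ h (Metric.ball 0 1))
    (hb : ∀ z ∈ Metric.ball (0 : ℂ) 1, ‖h z‖ < 1) {z : ℂ} (hz : ‖z‖ < 1) :
    ‖deriv h z‖ * (1 - ‖z‖ ^ 2) ≤ 1 - ‖h z‖ ^ 2 := by
  have hz' : ‖-z‖ < 1 := by simpa
  set τ : ℂ → ℂ := fun w => (w - -z) / (1 - starRingEnd ℂ (-z) * w) with hτ
  have τ0 : τ 0 = z := by simp [hτ]
  have τm : Set.MapsTo τ (Metric.ball 0 1) (Metric.ball 0 1) := fun w hw => by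
    simpa [hτ] using aux_mob_norm_lt hz' (by simpa using hw : ‖w‖ < 1)
  have τd : DifferentiableOn ℂ τ (Metric.ball 0 1) :=
    (differentiableOn_id.sub_const _).div ((differentiableOn_id.const_mul _).const_sub 1)
      (fun w hw => aux_den_ne hz' (by simpa using hw))
  have key := (aux_pick (h := h ∘ τ) (hd.comp τd τm) (fun w hw => hb _ (τm hw))).2
  have hden0 : 1 - starRingEnd ℂ (-z) * (0 : ℂ) ≠ 0 := by simp
  have hτ' : HasDerivAt τ (((1 - ‖z‖ ^ 2 : ℝ) : ℂ)) 0 := by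
    have := ((hasDerivAt_id (0 : ℂ)).sub_const (-z)).div
      (((hasDerivAt_id (0 : ℂ)).const_mul (starRingEnd ℂ (-z))).const_sub 1) hden0
    refine this.congr_deriv ?_
    have : ((‖z‖ ^ 2 : ℝ) : ℂ) = z * starRingEnd ℂ z := by
      rw [Complex.mul_conj, Complex.normSq_eq_norm_sq]
    push_cast at this ⊢
    rw [this]
    simp
    try ring
  have hh : HasDerivAt h (deriv h z) (τ 0) := by
    rw [τ0]
    exact (hd.differentiableAt (Metric.isOpen_ball.mem_nhds (by simpa using hz))).hasDerivAt
  have hpos : 0 < 1 - ‖z‖ ^ 2 := by nlinarith [norm_nonneg z]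
  rw [(hh.comp 0 hτ').deriv, norm_mul, Complex.norm_real, Real.norm_of_nonneg hpos.le] at key
  simpa [τ0] using key

/-- Schwarz-Pick consequences for a function bounded by `N` and equal to `1` at the origin. -/
lemma aux_P {g : ℂ → ℂ} {N : ℝ} (hN : 1 < N) (hd : DifferentiableOn ℂ g (Metric.ball 0 1))
    (hb : ∀ z ∈ Metric.ball (0 : ℂ) 1, ‖g z‖ < N) (g0 : g 0 = 1) {r : ℝ} (hr : r < 1)
    {z : ℂ} (hz : ‖z‖ ≤ r) :
    ‖g z - 1‖ ≤ r * (N ^ 2 - 1) / (N - r) ∧ ‖deriv g z‖ ≤ (N - 1 / N) / (1 - r) ^ 2 := by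
  have hN0 : 0 < N := by linarith
  have hr0 : 0 ≤ r := (norm_nonneg z).trans hz
  have hz1 : z ∈ Metric.ball (0 : ℂ) 1 := by simpa using hz.trans_lt hr
  have hNc : (N : ℂ) ≠ 0 := by exact_mod_cast hN0.ne'
  set h : ℂ → ℂ := fun z => g z / N with hh
  have hhd : DifferentiableOn ℂ h (Metric.ball 0 1) := hd.div_const _
  have hnorm : ∀ w, ‖h w‖ = ‖g w‖ / N := fun w => by
    simp [hh, abs_of_pos hN0]
  have hhb : ∀ z ∈ Metric.ball (0 : ℂ) 1, ‖h z‖ < 1 := fun w hw => by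
    rw [hnorm, div_lt_one hN0]; exact hb w hw
  have hP1 := (aux_pick hhd hhb).1 z hz1
  have h1 : ‖g z - 1‖ ≤ r * (N ^ 2 - 1) / (N - r) := by
    have e1 : h z - h 0 = (g z - 1) / N := by simp only [hh, g0]; ring
    have e2 : 1 - starRingEnd ℂ (h 0) * h z = ((N ^ 2 - 1 : ℝ) - (g z - 1)) / N ^ 2 := by
      simp [hh, g0]; field_simp
    rw [e1, e2, norm_div, norm_div, norm_pow, Complex.norm_real, Real.norm_of_nonneg hN0.le] at hP1
    have h3 : ‖((N ^ 2 - 1 : ℝ) : ℂ) - (g z - 1)‖ ≤ (N ^ 2 - 1) + ‖g z - 1‖ := by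
      refine (norm_sub_le _ _).trans ?_
      rw [Complex.norm_real, Real.norm_of_nonneg (by nlinarith)]
    have h4 : ‖g z - 1‖ / N ≤ r * (((N ^ 2 - 1) + ‖g z - 1‖) / N ^ 2) :=
      hP1.trans (by gcongr)
    rw [le_div_iff₀ (by linarith)]
    rw [← mul_div_assoc, div_le_div_iff₀ hN0 (by positivity)] at h4
    have : N * (‖g z - 1‖ * N) ≤ N * (r * (N ^ 2 - 1 + ‖g z - 1‖)) := by linarith
    have := le_of_mul_le_mul_left this hN0
    linarith
  refine ⟨h1, ?_⟩
  have hP2 := aux_pick_deriv hhd hhb (hz.trans_lt hr)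
  have e3 : deriv h z = deriv g z / N := by simp [hh]
  rw [e3, norm_div, Complex.norm_real, Real.norm_of_nonneg hN0.le, hnorm] at hP2
  -- s = ‖g z‖ ≥ N(1 - N r)/(N - r)
  have hs : N * (1 - N * r) ≤ ‖g z‖ * (N - r) := by
    have : 1 ≤ ‖g z‖ + ‖g z - 1‖ := by
      have := norm_sub_le (g z) (g z - 1)
      simpa using this
    rw [le_div_iff₀ (by linarith)] at h1
    nlinarith
  have hs2 : 1 - (‖g z‖ / N) ^ 2 ≤ (1 - 1 / N ^ 2) * (1 + r) / (1 - r) := by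
    set s := ‖g z‖ with hsdef
    have hs0 : 0 ≤ s := norm_nonneg _
    have key : (N ^ 2 - s ^ 2) * (1 - r) ≤ (N ^ 2 - 1) * (1 + r) := by
      rcases le_total (N * r) 1 with hc | hc
      · have hsq : (N * (1 - N * r)) ^ 2 ≤ (s * (N - r)) ^ 2 :=
          pow_le_pow_left₀ (mul_nonneg hN0.le (by linarith)) hs 2
        -- (N^2 - s^2)(N-r)^2 ≤ N^2 (N^2-1)(1-r^2)
        have h5 : (N ^ 2 - s ^ 2) * (N - r) ^ 2 ≤ N ^ 2 * ((N ^ 2 - 1) * (1 - r ^ 2)) := by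
          nlinarith
        have h6 : N * (1 - r) ≤ N - r := by nlinarith
        have h7 : (N * (1 - r)) ^ 2 ≤ (N - r) ^ 2 :=
          pow_le_pow_left₀ (mul_nonneg hN0.le (by linarith)) h6 2
        have hsN : 0 ≤ N ^ 2 - s ^ 2 := by
          have := hb z hz1
          nlinarith
        have h8 : (N ^ 2 - s ^ 2) * (N * (1 - r)) ^ 2 ≤ N ^ 2 * ((N ^ 2 - 1) * (1 - r ^ 2)) :=
          (mul_le_mul_of_nonneg_left h7 hsN).trans h5
        have h9 : (N ^ 2 * (1 - r)) * ((N ^ 2 - s ^ 2) * (1 - r))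
            ≤ (N ^ 2 * (1 - r)) * ((N ^ 2 - 1) * (1 + r)) := by nlinarith
        exact le_of_mul_le_mul_left h9 (mul_pos (by positivity) (by linarith))
      · have : N ^ 2 * (1 - r) ≤ (N ^ 2 - 1) * (1 + r) := by nlinarith
        nlinarith [mul_nonneg (sq_nonneg s) (by linarith : 0 ≤ 1 - r)]
    rw [le_div_iff₀ (by linarith)]
    have : 1 - (s / N) ^ 2 = (N ^ 2 - s ^ 2) / N ^ 2 := by field_simp
    rw [this]
    have : (1 - 1 / N ^ 2) * (1 + r) = (N ^ 2 - 1) * (1 + r) / N ^ 2 := by field_simp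
    rw [this, div_mul_eq_mul_div]
    gcongr
  have h10 : ‖deriv g z‖ / N * (1 - r ^ 2) ≤ (1 - 1 / N ^ 2) * (1 + r) / (1 - r) := by
    refine le_trans ?_ (hP2.trans hs2)
    gcongr
  rw [le_div_iff₀ (by linarith)] at h10
  have hr2 : 0 < 1 - r := by linarith
  rw [le_div_iff₀ (by positivity)]
  have e5 : ‖deriv g z‖ / N * (1 - r ^ 2) * (1 - r)
      = (1 + r) / N * (‖deriv g z‖ * (1 - r) ^ 2) := by field_simp; ring
  have e6 : (1 - 1 / N ^ 2) * (1 + r) = (1 + r) / N * (N - 1 / N) := by field_simp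
  rw [e5, e6] at h10
  exact le_of_mul_le_mul_left h10 (by positivity)

lemma aux_B {f : ℂ → ℂ} {M : ℝ} (hM : 1 < M) (hd : DifferentiableOn ℂ f (Metric.ball 0 1))
    (hb : ∀ z ∈ Metric.ball (0 : ℂ) 1, ‖f z‖ ≤ M) (f0 : f 0 = 0) (f1 : deriv f 0 = 1)
    {r : ℝ} (hr : r < 1) {z : ℂ} (hz : ‖z‖ ≤ r) :
    ‖f z‖ ≤ r + (M - 1 / M) * (r ^ 2 / (1 - r)) ∧
    ‖deriv f z‖ ≤ 1 + (M - 1 / M) * (r * (2 - r) / (1 - r) ^ 2) := by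
  have hM0 : 0 < M := by linarith
  have hr0 : 0 ≤ r := (norm_nonneg z).trans hz
  have hr2 : 0 < 1 - r := by linarith
  have h0 : (0 : ℂ) ∈ Metric.ball (0 : ℂ) 1 := by simp
  have hz1 : z ∈ Metric.ball (0 : ℂ) 1 := by simpa using hz.trans_lt hr
  set φ := dslope f 0 with hφ
  have φd : DifferentiableOn ℂ φ (Metric.ball 0 1) :=
    (Complex.differentiableOn_dslope (Metric.isOpen_ball.mem_nhds h0)).2 hd
  have φ0 : φ 0 = 1 := by simp [hφ, f1]
  have φle : ∀ w ∈ Metric.ball (0 : ℂ) 1, ‖φ w‖ ≤ M := fun w hw => by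
    have := Complex.norm_dslope_le_div_of_mapsTo_ball (R₂ := M) hd
      (fun x hx => by simpa [f0] using hb x hx) hw
    simpa using this
  have φlt : ∀ w ∈ Metric.ball (0 : ℂ) 1, ‖φ w‖ < M := fun w hw => by
    refine lt_of_le_of_ne (φle w hw) fun he => ?_
    have hm : IsMaxOn (norm ∘ φ) (Metric.ball 0 1) w := fun x hx => by
      simpa [he] using φle x hx
    have := Complex.norm_eqOn_of_isPreconnected_of_isMaxOn
      (convex_ball (0 : ℂ) 1).isPreconnected Metric.isOpen_ball φd hw hm h0
    simp [φ0, he] at this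
    linarith
  have fφ : ∀ w, f w = w * φ w := fun w => by
    have := sub_smul_dslope f 0 w
    simp [f0] at this
    rw [hφ, this]
  obtain ⟨b1, b2⟩ := aux_P hM φd φlt φ0 hr hz
  have hc : 0 ≤ M - 1 / M := by
    have : 1 / M < 1 := by rw [div_lt_one hM0]; exact hM
    linarith
  have b1' : ‖φ z - 1‖ ≤ (M - 1 / M) * (r / (1 - r)) := by
    refine b1.trans ?_
    have : (M - 1 / M) * (r / (1 - r)) = r * (M ^ 2 - 1) / (M * (1 - r)) := by
      field_simp
    rw [this]
    have : 0 ≤ r * (M ^ 2 - 1) := mul_nonneg hr0 (by nlinarith)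
    gcongr
    nlinarith
  have b3 : ‖φ z‖ ≤ 1 + (M - 1 / M) * (r / (1 - r)) := by
    have := norm_add_le (1 : ℂ) (φ z - 1)
    rw [add_sub_cancel, norm_one] at this
    linarith
  constructor
  · rw [fφ, norm_mul]
    calc ‖z‖ * ‖φ z‖ ≤ r * (1 + (M - 1 / M) * (r / (1 - r))) := by gcongr
      _ = _ := by field_simp
  · have hφz : HasDerivAt φ (deriv φ z) z :=
      (φd.differentiableAt (Metric.isOpen_ball.mem_nhds hz1)).hasDerivAt
    have hf : HasDerivAt f (1 * φ z + z * deriv φ z) z := by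
      have := (hasDerivAt_id z).mul hφz
      have hfe : f = id * φ := funext fun w => by simp [← fφ]
      rw [hfe]; exact this
    rw [hf.deriv, one_mul]
    calc ‖φ z + z * deriv φ z‖ ≤ ‖φ z‖ + ‖z‖ * ‖deriv φ z‖ := by
          rw [← norm_mul]; exact norm_add_le _ _
      _ ≤ (1 + (M - 1 / M) * (r / (1 - r))) + r * ((M - 1 / M) / (1 - r) ^ 2) := by gcongr
      _ = _ := by field_simp; ring

lemma aux_pow (k : ℕ) {r : ℝ} {z w : ℂ} (hz : ‖z‖ ≤ r) (hw : ‖w‖ ≤ r) :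
    ‖z ^ k - w ^ k‖ ≤ k * r ^ (k - 1) * ‖z - w‖ := by
  refine (convex_closedBall (0 : ℂ) r).norm_image_sub_le_of_norm_hasDerivWithin_le
    (f := fun x : ℂ => x ^ k) (f' := fun x : ℂ => (k : ℂ) * x ^ (k - 1))
    (fun x _ => (hasDerivAt_pow k x).hasDerivWithinAt) (fun x hx => ?_)
    (by simpa using hw) (by simpa using hz)
  have : ‖x‖ ≤ r := by simpa using hx
  rw [norm_mul, norm_pow, Complex.norm_natCast]
  gcongr

lemma aux_term {f : ℂ → ℂ} {M : ℝ} (hM : 1 < M) (hd : DifferentiableOn ℂ f (Metric.ball 0 1))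
    (hb : ∀ z ∈ Metric.ball (0 : ℂ) 1, ‖f z‖ ≤ M) (f0 : f 0 = 0) (f1 : deriv f 0 = 1)
    {r : ℝ} (hr : r < 1) {z w : ℂ} (hz : ‖z‖ ≤ r) (hw : ‖w‖ ≤ r) {k : ℕ} (hk : 1 ≤ k) :
    ‖(starRingEnd ℂ z) ^ k * f z - (starRingEnd ℂ w) ^ k * f w‖ ≤
      ((M - 1 / M) * (r ^ (k + 1) * (2 - r + (k : ℝ) * (1 - r)) / (1 - r) ^ 2)
        + ((k : ℝ) + 1) * r ^ k) * ‖z - w‖ := by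
  have hr0 : 0 ≤ r := (norm_nonneg z).trans hz
  have hr2 : 0 < 1 - r := by linarith
  have hlip : ‖f z - f w‖ ≤ (1 + (M - 1 / M) * (r * (2 - r) / (1 - r) ^ 2)) * ‖z - w‖ := by
    refine (convex_closedBall (0 : ℂ) r).norm_image_sub_le_of_norm_hasDerivWithin_le
      (f' := deriv f) (fun x hx => ?_) (fun x hx => ?_) (by simpa using hw) (by simpa using hz)
    · have hx' : ‖x‖ ≤ r := by simpa using hx
      exact (hd.differentiableAt (Metric.isOpen_ball.mem_nhds
        (by simpa using hx'.trans_lt hr))).hasDerivAt.hasDerivWithinAt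
    · exact (aux_B hM hd hb f0 f1 hr (by simpa using hx)).2
  have hfw := (aux_B hM hd hb f0 f1 hr hw).1
  have hp := aux_pow k (z := starRingEnd ℂ z) (w := starRingEnd ℂ w) (r := r)
    (by simpa using hz) (by simpa using hw)
  rw [← map_sub, RCLike.norm_conj] at hp
  have hsplit : (starRingEnd ℂ z) ^ k * f z - (starRingEnd ℂ w) ^ k * f w
      = (starRingEnd ℂ z) ^ k * (f z - f w)
        + ((starRingEnd ℂ z) ^ k - (starRingEnd ℂ w) ^ k) * f w := by ring
  rw [hsplit]
  refine (norm_add_le _ _).trans ?_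
  rw [norm_mul, norm_mul, norm_pow, RCLike.norm_conj]
  calc _ ≤ r ^ k * ((1 + (M - 1 / M) * (r * (2 - r) / (1 - r) ^ 2)) * ‖z - w‖)
        + (k * r ^ (k - 1) * ‖z - w‖) * (r + (M - 1 / M) * (r ^ 2 / (1 - r))) := by gcongr
    _ = _ := by
      obtain ⟨m, rfl⟩ : ∃ m, k = m + 1 := ⟨k - 1, by omega⟩
      simp only [Nat.add_sub_cancel]
      field_simp
      push_cast
      ring

theorem stmt19 (p : ℕ) (hp : 0 < p) (Λ : ℝ) (hΛ : 1 < Λ) (M : ℕ → ℝ)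
    (hM : ∀ k ∈ Finset.Icc 1 (p - 1), 1 < M k)
    (A : ℕ → ℂ → ℂ)
    (hA : ∀ k ∈ Finset.range p, DifferentiableOn ℂ (A k) (Metric.ball 0 1))
    (hA0 : ∀ k ∈ Finset.range p, A k 0 = 0)
    (hA'0 : ∀ k ∈ Finset.range p, deriv (A k) 0 = 1)
    (hA0' : ∀ z ∈ Metric.ball (0 : ℂ) 1, ‖deriv (A 0) z‖ < Λ)
    (hAM : ∀ k ∈ Finset.Icc 1 (p - 1), ∀ z ∈ Metric.ball (0 : ℂ) 1, ‖A k z‖ ≤ M k)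
    (F : ℂ → ℂ)
    (hF : ∀ z, F z = ∑ k ∈ Finset.range p, (starRingEnd ℂ z) ^ k * A k z)
    (ρ₄ : ℝ) (hρ₄ : ρ₄ ∈ Set.Ioo (0 : ℝ) 1)
    (hroot : Λ * (1 - Λ * ρ₄) / (Λ - ρ₄)
      - (∑ k ∈ Finset.Icc 1 (p - 1),
          (M k - 1 / M k) * (ρ₄ ^ (k + 1) * (2 - ρ₄ + (k : ℝ) * (1 - ρ₄)) / (1 - ρ₄) ^ 2))
      - (∑ k ∈ Finset.Icc 1 (p - 1), ((k : ℝ) + 1) * ρ₄ ^ k) = 0) :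
    Set.InjOn F (Metric.ball 0 ρ₄) := by
  obtain ⟨hρ0, hρ1⟩ := hρ₄
  have hp0 : 0 ∈ Finset.range p := by simpa using hp
  intro z hz w hw hzw
  by_contra hne
  have hz' : ‖z‖ < ρ₄ := by simpa using hz
  have hw' : ‖w‖ < ρ₄ := by simpa using hw
  have hd : 0 < ‖z - w‖ := norm_pos_iff.2 (sub_ne_zero.2 hne)
  set r := max ‖z‖ ‖w‖ with hr
  have hr1 : r < ρ₄ := max_lt hz' hw'
  have hr0 : 0 ≤ r := (norm_nonneg z).trans (le_max_left _ _)
  have hA0d := hA 0 hp0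
  -- the analytic part
  have h0 : ‖(A 0 z - z) - (A 0 w - w)‖ ≤ r * (Λ ^ 2 - 1) / (Λ - r) * ‖z - w‖ := by
    refine (convex_closedBall (0 : ℂ) r).norm_image_sub_le_of_norm_hasDerivWithin_le
      (f := fun x => A 0 x - x) (f' := fun x => deriv (A 0) x - 1)
      (fun x hx => ?_) (fun x hx => ?_) (by simp [hr]) (by simp [hr])
    · have hx' : ‖x‖ ≤ r := by simpa using hx
      exact ((hA0d.differentiableAt (Metric.isOpen_ball.mem_nhds
        (by simpa using hx'.trans_lt (hr1.trans hρ1)))).hasDerivAt.sub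
          (hasDerivAt_id x)).hasDerivWithinAt
    · exact (aux_P hΛ (hA0d.deriv Metric.isOpen_ball) hA0' (hA'0 0 hp0) (hr1.trans hρ1)
        (by simpa using hx)).1
  have hlt : r * (Λ ^ 2 - 1) / (Λ - r) < ρ₄ * (Λ ^ 2 - 1) / (Λ - ρ₄) := by
    have : 0 < Λ ^ 2 - 1 := by nlinarith
    rw [div_lt_div_iff₀ (by linarith) (by linarith)]
    nlinarith [mul_pos this (sub_pos.2 hr1), mul_pos (mul_pos this (sub_pos.2 hr1)) (by linarith : 0 < Λ)]
  have heq : Λ * (1 - Λ * ρ₄) / (Λ - ρ₄) = 1 - ρ₄ * (Λ ^ 2 - 1) / (Λ - ρ₄) := by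
    have : Λ - ρ₄ ≠ 0 := by linarith
    field_simp
    ring
  have hset : Finset.range p = insert 0 (Finset.Icc 1 (p - 1)) := by
    ext x; simp; omega
  have hFs : ∀ x, F x = A 0 x + ∑ k ∈ Finset.Icc 1 (p - 1), (starRingEnd ℂ x) ^ k * A k x := by
    intro x
    rw [hF, hset, Finset.sum_insert (by simp)]
    simp
  have hsum : ‖(∑ k ∈ Finset.Icc 1 (p - 1), (starRingEnd ℂ z) ^ k * A k z)
      - ∑ k ∈ Finset.Icc 1 (p - 1), (starRingEnd ℂ w) ^ k * A k w‖ ≤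
      ((∑ k ∈ Finset.Icc 1 (p - 1),
          (M k - 1 / M k) * (ρ₄ ^ (k + 1) * (2 - ρ₄ + (k : ℝ) * (1 - ρ₄)) / (1 - ρ₄) ^ 2))
      + (∑ k ∈ Finset.Icc 1 (p - 1), ((k : ℝ) + 1) * ρ₄ ^ k)) * ‖z - w‖ := by
    rw [← Finset.sum_sub_distrib, ← Finset.sum_add_distrib, Finset.sum_mul]
    refine norm_sum_le_of_le _ fun k hk => ?_
    have hk' : k ∈ Finset.range p := by rw [hset]; exact Finset.mem_insert_of_mem hk
    exact aux_term (hM k hk) (hA k hk') (hAM k hk) (hA0 k hk') (hA'0 k hk') hρ1 hz'.le hw'.le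
      (Finset.mem_Icc.1 hk).1
  rw [hFs, hFs] at hzw
  set S := ∑ k ∈ Finset.Icc 1 (p - 1), (starRingEnd ℂ z) ^ k * A k z
  set T := ∑ k ∈ Finset.Icc 1 (p - 1), (starRingEnd ℂ w) ^ k * A k w
  have hid : z - w = -(((A 0 z - z) - (A 0 w - w)) + (S - T)) := by linear_combination hzw
  have hfin : ‖z - w‖ ≤ ‖(A 0 z - z) - (A 0 w - w)‖ + ‖S - T‖ := by
    calc ‖z - w‖ = ‖((A 0 z - z) - (A 0 w - w)) + (S - T)‖ := by
          conv_lhs => rw [hid, norm_neg]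
      _ ≤ _ := norm_add_le _ _
  rw [heq] at hroot
  have := mul_lt_mul_of_pos_right hlt hd
  nlinarith
end
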